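/- For every integer N ≥ 1, the function ℳ : (0,1) → (0,∞) defined by ℳ(p₀) = 𝒯(p₀)·[2N ℬ(p₀) + 1 − √(1 − p₀²)] is continuously differentiable and strictly decreasing on (0,1); that is, ℳ'(p₀) < 0 for every p₀ ∈ (0,1). -/

import Mathlib

open Real MeasureTheory Set Filter Topology

/-- The potential `A(u) = u²(1 − u²)`. -/
noncomputable def A (u : ℝ) : ℝ := u ^ 2 * (1 - u ^ 2)

/-- `p⋆ = 1/√2`, the unique positive critical point of `A`, with `A p⋆ = 1/4`. -/
noncomputable def pstar : ℝ := 1 / Real.sqrt 2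

/-- For energy `E > −1/4`, the unique root `p₊ > p⋆` of `A(p₊) = −E` (explicit formula). -/
noncomputable def pPlus (E : ℝ) : ℝ := Real.sqrt ((1 + Real.sqrt (1 + 4 * E)) / 2)

/-- For energy `E ∈ (−1/4, 0)`, the unique root `p₋ ∈ (0, p⋆)` of `A(p₋) = −E` (explicit formula). -/
noncomputable def pMinus (E : ℝ) : ℝ := Real.sqrt ((1 - Real.sqrt (1 + 4 * E)) / 2)

/-- The period function `T₊(p₀,q₀) = ∫_{p₀}^{p₊} du/√(E + A(u))`, `E = q₀² − A(p₀)`. -/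
noncomputable def Tplus (p₀ q₀ : ℝ) : ℝ :=
  ∫ u in p₀..pPlus (q₀ ^ 2 - A p₀), 1 / Real.sqrt ((q₀ ^ 2 - A p₀) + A u)

/-- The period function `T₋(p₀,q₀) = ∫_{p₋}^{p₀} du/√(E + A(u))`, `E = q₀² − A(p₀)`. -/
noncomputable def Tminus (p₀ q₀ : ℝ) : ℝ :=
  ∫ u in pMinus (q₀ ^ 2 - A p₀)..p₀, 1 / Real.sqrt ((q₀ ^ 2 - A p₀) + A u)

/-- The energy level `E₀(p₀) = −(1 − 1/(4N²)) A(p₀)`. -/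
noncomputable def Ezero (N : ℕ) (p₀ : ℝ) : ℝ := -(1 - 1 / (4 * (N : ℝ) ^ 2)) * A p₀

/-- `𝒯(p₀) = ∫_{p₀}^{p₊} du/√(E₀(p₀) + A(u))`. -/
noncomputable def calT (N : ℕ) (p₀ : ℝ) : ℝ :=
  ∫ u in p₀..pPlus (Ezero N p₀), 1 / Real.sqrt (Ezero N p₀ + A u)

/-- `ℬ(p₀) = ∫_{p₀}^{p₊} u² du/√(E₀(p₀) + A(u))`. -/
noncomputable def calB (N : ℕ) (p₀ : ℝ) : ℝ :=
  ∫ u in p₀..pPlus (Ezero N p₀), u ^ 2 / Real.sqrt (Ezero N p₀ + A u)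

/-- `ℳ(p₀) = 𝒯(p₀)·[2N ℬ(p₀) + 1 − √(1 − p₀²)]` (equal to `π` times the mass). -/
noncomputable def calM (N : ℕ) (p₀ : ℝ) : ℝ :=
  calT N p₀ * (2 * (N : ℝ) * calB N p₀ + 1 - Real.sqrt (1 - p₀ ^ 2))

/-- Leibniz rule for `x ↦ ∫ θ in 0..φ x, F (δ x) θ`, with both a moving endpoint and a moving
parameter. -/
theorem hasDerivAt_integral_parametric_endpoint {F F' : ℝ → ℝ → ℝ} {δ φ : ℝ → ℝ}
    {x₀ δ' φ' r K : ℝ} (hr : 0 < r)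
    (hF : ∀ d ∈ Metric.ball (δ x₀) r, Continuous (F d))
    (hF' : Continuous (F' (δ x₀)))
    (hdiff : ∀ d ∈ Metric.ball (δ x₀) r, ∀ θ, HasDerivAt (fun d => F d θ) (F' d θ) d)
    (hK : ∀ d ∈ Metric.ball (δ x₀) r, ∀ θ, ‖F' d θ‖ ≤ K)
    (hδ : HasDerivAt δ δ' x₀) (hφ : HasDerivAt φ φ' x₀) :
    HasDerivAt (fun x => ∫ θ in (0)..φ x, F (δ x) θ)
      (F (δ x₀) (φ x₀) * φ' + δ' * ∫ θ in (0)..φ x₀, F' (δ x₀) θ) x₀ := by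
  have hball : Metric.ball (δ x₀) r ∈ 𝓝 (δ x₀) := Metric.ball_mem_nhds _ hr
  have h0 : δ x₀ ∈ Metric.ball (δ x₀) r := Metric.mem_ball_self hr
  have h1 : HasDerivAt (fun d => ∫ θ in (0)..φ x₀, F d θ)
      (∫ θ in (0)..φ x₀, F' (δ x₀) θ) (δ x₀) := by
    refine (intervalIntegral.hasDerivAt_integral_of_dominated_loc_of_deriv_le (bound := fun _ => K)
      (F' := F') hball ?_ ((hF _ h0).intervalIntegrable _ _) hF'.aestronglyMeasurable ?_
      intervalIntegrable_const ?_).2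
    · filter_upwards [hball] with d hd using (hF d hd).aestronglyMeasurable
    · exact Eventually.of_forall fun θ _ d hd => hK d hd θ
    · exact Eventually.of_forall fun θ _ d hd => hdiff d hd θ
  have h2 : HasDerivAt (fun b => ∫ θ in (0)..b, F (δ x₀) θ) (F (δ x₀) (φ x₀)) (φ x₀) :=
    intervalIntegral.integral_hasDerivAt_right ((hF _ h0).intervalIntegrable _ _)
      ((hF _ h0).stronglyMeasurableAtFilter _ _) (hF _ h0).continuousAt
  have hlip : ∀ d ∈ Metric.ball (δ x₀) r, ∀ θ, ‖F d θ - F (δ x₀) θ‖ ≤ K * ‖d - δ x₀‖ := by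
    intro d hd θ
    exact (convex_ball _ _).norm_image_sub_le_of_norm_hasDerivWithin_le
      (f := fun d => F d θ) (f' := fun d => F' d θ)
      (fun e he => (hdiff e he θ).hasDerivWithinAt) (fun e he => hK e he θ) h0 hd
  have h3 : HasDerivAt (fun x => ∫ θ in (φ x₀)..φ x, (F (δ x) θ - F (δ x₀) θ)) 0 x₀ := by
    rw [hasDerivAt_iff_isLittleO]
    have hb : (fun x => ∫ θ in (φ x₀)..φ x, (F (δ x) θ - F (δ x₀) θ))
        =O[𝓝 x₀] fun x => (δ x - δ x₀) * (φ x - φ x₀) := by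
      refine Asymptotics.IsBigO.of_bound K ?_
      filter_upwards [hδ.continuousAt hball] with x hx
      refine (intervalIntegral.norm_integral_le_of_norm_le_const
        (fun θ _ => hlip _ hx θ)).trans_eq ?_
      rw [norm_mul, Real.norm_eq_abs, Real.norm_eq_abs, mul_assoc]
    have hl : (fun x => (δ x - δ x₀) * (φ x - φ x₀)) =o[𝓝 x₀] fun x => 1 * (x - x₀) := by
      refine Asymptotics.IsLittleO.mul_isBigO ?_ hφ.isBigO_sub
      rw [Asymptotics.isLittleO_one_iff]
      exact tendsto_sub_nhds_zero_iff.2 hδ.continuousAt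
    simpa using hb.trans_isLittleO hl
  have h4 := (((h1.comp x₀ hδ).add (h2.comp x₀ hφ)).add h3).sub_const
    (∫ θ in (0)..φ x₀, F (δ x₀) θ)
  refine (h4.congr_of_eventuallyEq ?_).congr_deriv (by ring)
  filter_upwards [hδ.continuousAt hball] with x hx
  have i1 := fun a b => (hF _ hx).intervalIntegrable (μ := volume) a b
  have i2 := fun a b => (hF _ h0).intervalIntegrable (μ := volume) a b
  simp only [Pi.add_apply, Function.comp_apply]
  rw [intervalIntegral.integral_sub (i1 _ _) (i2 _ _),
    ← intervalIntegral.integral_add_adjacent_intervals (i1 0 (φ x₀)) (i1 (φ x₀) (φ x)),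
    ← intervalIntegral.integral_add_adjacent_intervals (i2 0 (φ x₀)) (i2 (φ x₀) (φ x))]
  ring

/-- `δ = √(1 + 4E)` as a function of `x = 2p² - 1`, where `ε = 1 / (2N)`. -/
noncomputable def modulus (ε x : ℝ) : ℝ := √(ε ^ 2 + (1 - ε ^ 2) * x ^ 2)

/-- The amplitude `φ ∈ (0, π)` with `cos φ = x / δ`. -/
noncomputable def amplitude (ε x : ℝ) : ℝ := arccos (x / modulus ε x)

/-- The incomplete integral `∫₀^φ (1 + δ cos θ)^s dθ`. -/
noncomputable def lobeIntegral (ε s x : ℝ) : ℝ :=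
  ∫ θ in (0)..amplitude ε x, (1 + modulus ε x * cos θ) ^ s

section Modulus

variable {ε x : ℝ}

theorem modulus_sq (hε : ε ∈ Ioo (0 : ℝ) 1) :
    modulus ε x ^ 2 = ε ^ 2 + (1 - ε ^ 2) * x ^ 2 := by
  have : 0 < 1 - ε ^ 2 := by nlinarith [hε.1, hε.2]
  exact sq_sqrt (by positivity)

theorem modulus_pos (hε : ε ∈ Ioo (0 : ℝ) 1) : 0 < modulus ε x := by
  have : 0 < 1 - ε ^ 2 := by nlinarith [hε.1, hε.2]
  have := hε.1
  exact sqrt_pos.2 (by positivity)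

theorem modulus_lt_one (hε : ε ∈ Ioo (0 : ℝ) 1) (hx : x ∈ Ioo (-1 : ℝ) 1) : modulus ε x < 1 := by
  have h1 : 0 < 1 - ε ^ 2 := by nlinarith [hε.1, hε.2]
  have h2 : 0 < 1 - x ^ 2 := by nlinarith [hx.1, hx.2]
  have h3 := modulus_sq (x := x) hε
  nlinarith [mul_pos h1 h2, modulus_pos (x := x) hε]

theorem abs_lt_modulus (hε : ε ∈ Ioo (0 : ℝ) 1) (hx : x ∈ Ioo (-1 : ℝ) 1) :
    |x| < modulus ε x := by
  have h2 : 0 < 1 - x ^ 2 := by nlinarith [hx.1, hx.2]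
  refine abs_lt_of_sq_lt_sq ?_ (modulus_pos hε).le
  rw [modulus_sq hε]
  nlinarith [mul_pos (pow_pos hε.1 2) h2]

theorem div_modulus_mem (hε : ε ∈ Ioo (0 : ℝ) 1) (hx : x ∈ Ioo (-1 : ℝ) 1) :
    x / modulus ε x ∈ Ioo (-1 : ℝ) 1 := by
  have h := abs_lt.1 (abs_lt_modulus hε hx)
  have h0 := modulus_pos (x := x) hε
  constructor
  · rw [lt_div_iff₀ h0]; linarith
  · rw [div_lt_one h0]; exact h.2

theorem modulus_mul_cos_amplitude (hε : ε ∈ Ioo (0 : ℝ) 1) (hx : x ∈ Ioo (-1 : ℝ) 1) :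
    modulus ε x * cos (amplitude ε x) = x := by
  have h := div_modulus_mem hε hx
  rw [amplitude, cos_arccos h.1.le h.2.le, mul_div_cancel₀ _ (modulus_pos hε).ne']

theorem modulus_mul_sin_amplitude (hε : ε ∈ Ioo (0 : ℝ) 1) (hx : x ∈ Ioo (-1 : ℝ) 1) :
    modulus ε x * sin (amplitude ε x) = ε * (√(1 + x) * √(1 - x)) := by
  have h0 := modulus_pos (x := x) hε
  rw [← sqrt_mul (by linarith [hx.1]), amplitude, sin_arccos]
  refine (sq_eq_sq₀ (by positivity) (mul_nonneg hε.1.le (sqrt_nonneg _))).1 ?_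
  have h := div_modulus_mem hε hx
  rw [mul_pow, mul_pow, sq_sqrt (by nlinarith [h.1, h.2]),
    sq_sqrt (by nlinarith [hx.1, hx.2]), mul_sub, div_pow, mul_div_cancel₀ _ (by positivity),
    modulus_sq hε]
  ring

theorem amplitude_pos (hε : ε ∈ Ioo (0 : ℝ) 1) (hx : x ∈ Ioo (-1 : ℝ) 1) : 0 < amplitude ε x :=
  arccos_pos.2 (div_modulus_mem hε hx).2

theorem amplitude_le_pi : amplitude ε x ≤ π := arccos_le_pi _

theorem one_add_mul_cos_pos {d : ℝ} (hd : |d| < 1) (θ : ℝ) : 0 < 1 + d * cos θ := by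
  have h : |d * cos θ| < 1 := by
    rw [abs_mul]
    nlinarith [abs_cos_le_one θ, abs_nonneg d, abs_nonneg (cos θ)]
  linarith [(abs_lt.1 h).1]

theorem abs_modulus_lt_one (hε : ε ∈ Ioo (0 : ℝ) 1) (hx : x ∈ Ioo (-1 : ℝ) 1) :
    |modulus ε x| < 1 := by
  rw [abs_of_pos (modulus_pos hε)]; exact modulus_lt_one hε hx

theorem lobe_base_pos (hε : ε ∈ Ioo (0 : ℝ) 1) (hx : x ∈ Ioo (-1 : ℝ) 1) (θ : ℝ) :
    0 < 1 + modulus ε x * cos θ :=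
  one_add_mul_cos_pos (abs_modulus_lt_one hε hx) θ

theorem continuous_one_add_mul_cos_rpow {d : ℝ} (hd : |d| < 1) (s : ℝ) :
    Continuous fun θ => (1 + d * cos θ) ^ s :=
  Continuous.rpow_const (by fun_prop) fun θ => Or.inl (one_add_mul_cos_pos hd θ).ne'

theorem hasDerivAt_modulus (hε : ε ∈ Ioo (0 : ℝ) 1) :
    HasDerivAt (modulus ε) ((1 - ε ^ 2) * x / modulus ε x) x := by
  have h0 := modulus_pos (x := x) hε
  have h : HasDerivAt (fun x : ℝ => ε ^ 2 + (1 - ε ^ 2) * x ^ 2) ((1 - ε ^ 2) * (2 * x)) x := by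
    simpa using ((hasDerivAt_pow 2 x).const_mul (1 - ε ^ 2)).const_add (ε ^ 2)
  refine (h.sqrt (sqrt_pos.1 h0).ne').congr_deriv ?_
  change _ / (2 * modulus ε x) = _
  field_simp

theorem hasDerivAt_amplitude (hε : ε ∈ Ioo (0 : ℝ) 1) (hx : x ∈ Ioo (-1 : ℝ) 1) :
    HasDerivAt (amplitude ε) (-ε / (modulus ε x ^ 2 * (√(1 + x) * √(1 - x)))) x := by
  have h0 := modulus_pos (x := x) hε
  have h := div_modulus_mem hε hx
  have ha : 0 < √(1 + x) := sqrt_pos.2 (by linarith [hx.1])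
  have hb : 0 < √(1 - x) := sqrt_pos.2 (by linarith [hx.2])
  refine ((hasDerivAt_arccos h.1.ne' h.2.ne).comp x
    ((hasDerivAt_id x).div (hasDerivAt_modulus hε) h0.ne')).congr_deriv ?_
  have hs : √(1 - (x / modulus ε x) ^ 2) = ε * (√(1 + x) * √(1 - x)) / modulus ε x := by
    rw [eq_div_iff h0.ne', mul_comm, ← modulus_mul_sin_amplitude hε hx, amplitude, sin_arccos]
  have hε0 := hε.1
  have hm := modulus_sq (x := x) hε
  simp only [id_eq]
  rw [hs]
  field_simp
  linear_combination -hm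

end Modulus

section LobeIntegral

variable {ε x s : ℝ}

theorem hasDerivAt_lobeIntegral (hε : ε ∈ Ioo (0 : ℝ) 1) (hx : x ∈ Ioo (-1 : ℝ) 1) (s : ℝ) :
    HasDerivAt (lobeIntegral ε s)
      ((1 + x) ^ s * (-ε / (modulus ε x ^ 2 * (√(1 + x) * √(1 - x)))) +
        s * ((1 - ε ^ 2) * x / modulus ε x ^ 2) *
          (lobeIntegral ε s x - lobeIntegral ε (s - 1) x)) x := by
  have h0 := modulus_pos (x := x) hε
  have h1 := modulus_lt_one hε hx
  set m := (1 - modulus ε x) / 2 with hm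
  have hball : ∀ d ∈ Metric.ball (modulus ε x) m, |d| < 1 - m := by
    intro d hd
    rw [Metric.mem_ball, Real.dist_eq, abs_lt] at hd
    rw [abs_lt]
    constructor <;> linarith [hd.1, hd.2]
  have hmem : ∀ d ∈ Metric.ball (modulus ε x) m, ∀ θ, 1 + d * cos θ ∈ Icc m 2 := by
    intro d hd θ
    have hc : |d * cos θ| ≤ 1 - m := by
      rw [abs_mul]
      nlinarith [abs_cos_le_one θ, abs_nonneg d, abs_nonneg (cos θ), hball d hd]
    have := abs_le.1 hc
    constructor <;> linarith
  have hpos : ∀ d ∈ Metric.ball (modulus ε x) m, ∀ θ, 0 < 1 + d * cos θ := fun d hd θ =>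
    one_add_mul_cos_pos (by linarith [hball d hd]) θ
  obtain ⟨K, hK⟩ := isCompact_Icc.exists_bound_of_continuousOn (s := Icc m 2)
    (f := fun w : ℝ => s * w ^ (s - 1)) (continuousOn_const.mul fun w hw =>
      (continuousAt_rpow_const w (s - 1) (Or.inl (by linarith [hw.1]))).continuousWithinAt)
  refine (hasDerivAt_integral_parametric_endpoint (r := m) (K := K)
    (F := fun d θ => (1 + d * cos θ) ^ s)
    (F' := fun d θ => s * (1 + d * cos θ) ^ (s - 1) * cos θ) (by linarith)
    (fun d hd => continuous_one_add_mul_cos_rpow (by linarith [hball d hd]) s) ?_ ?_ ?_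
    (hasDerivAt_modulus hε) (hasDerivAt_amplitude hε hx)).congr_deriv ?_
  · exact (continuous_const.mul (continuous_one_add_mul_cos_rpow
      (abs_modulus_lt_one hε hx) (s - 1))).mul continuous_cos
  · intro d hd θ
    have h : HasDerivAt (fun d => 1 + d * cos θ) (cos θ) d := by
      simpa using ((hasDerivAt_id d).mul_const (cos θ)).const_add 1
    exact (h.rpow_const (p := s) (Or.inl (hpos d hd θ).ne')).congr_deriv (by ring)
  · intro d hd θ
    rw [norm_mul]
    have h2 := hK _ (hmem d hd θ)
    have h3 := abs_cos_le_one θ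
    rw [← Real.norm_eq_abs] at h3
    nlinarith [norm_nonneg (s * (1 + d * cos θ) ^ (s - 1)), norm_nonneg (cos θ)]
  · have hc := fun s => (continuous_one_add_mul_cos_rpow
      (abs_modulus_lt_one hε hx) s).intervalIntegrable (μ := volume) 0 (amplitude ε x)
    have hI : ∫ θ in (0)..amplitude ε x, s * (1 + modulus ε x * cos θ) ^ (s - 1) * cos θ =
        s / modulus ε x * (lobeIntegral ε s x - lobeIntegral ε (s - 1) x) := by
      rw [lobeIntegral, lobeIntegral, ← intervalIntegral.integral_sub (hc _) (hc _),
        ← intervalIntegral.integral_const_mul]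
      refine intervalIntegral.integral_congr fun θ _ => ?_
      have hw := lobe_base_pos hε hx θ
      rw [show s = s - 1 + 1 by ring, rpow_add_one hw.ne']
      simp only [add_sub_cancel_right]
      field_simp
      ring
    rw [hI, modulus_mul_cos_amplitude hε hx]
    field_simp

theorem lobeIntegral_pos (hε : ε ∈ Ioo (0 : ℝ) 1) (hx : x ∈ Ioo (-1 : ℝ) 1) :
    0 < lobeIntegral ε s x :=
  intervalIntegral.intervalIntegral_pos_of_pos
    ((continuous_one_add_mul_cos_rpow (abs_modulus_lt_one hε hx) s).intervalIntegrable _ _)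
    (fun θ => rpow_pos_of_pos (lobe_base_pos hε hx θ) s) (amplitude_pos hε hx)

theorem lobeIntegral_add_one_sub (hε : ε ∈ Ioo (0 : ℝ) 1) (hx : x ∈ Ioo (-1 : ℝ) 1) :
    lobeIntegral ε (s + 1) x - lobeIntegral ε s x =
      ∫ θ in (0)..amplitude ε x, modulus ε x * cos θ * (1 + modulus ε x * cos θ) ^ s := by
  have hc := fun s => (continuous_one_add_mul_cos_rpow
    (abs_modulus_lt_one hε hx) s).intervalIntegrable (μ := volume) 0 (amplitude ε x)
  rw [lobeIntegral, lobeIntegral, ← intervalIntegral.integral_sub (hc _) (hc _)]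
  refine intervalIntegral.integral_congr fun θ _ => ?_
  rw [rpow_add_one (lobe_base_pos hε hx θ).ne']
  ring

theorem lobeIntegral_add_one_sub_le (hε : ε ∈ Ioo (0 : ℝ) 1) (hx : x ∈ Ioo (-1 : ℝ) 1)
    (hs : s ≤ 0) :
    lobeIntegral ε (s + 1) x - lobeIntegral ε s x ≤ ε * (√(1 + x) * √(1 - x)) := by
  have hc := continuous_one_add_mul_cos_rpow (abs_modulus_lt_one hε hx) s
  rw [lobeIntegral_add_one_sub hε hx, ← modulus_mul_sin_amplitude hε hx]
  have hsin : modulus ε x * sin (amplitude ε x) =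
      ∫ θ in (0)..amplitude ε x, modulus ε x * cos θ := by
    rw [intervalIntegral.integral_const_mul, integral_cos, sin_zero, sub_zero]
  rw [hsin]
  refine intervalIntegral.integral_mono_on (amplitude_pos hε hx).le
    (((continuous_const.mul continuous_cos).mul hc).intervalIntegrable _ _)
    ((continuous_const.mul continuous_cos).intervalIntegrable _ _) fun θ _ => ?_
  have hw := lobe_base_pos hε hx θ
  rcases le_total 0 (modulus ε x * cos θ) with h | h
  · have := rpow_le_one_of_one_le_of_nonpos (x := 1 + modulus ε x * cos θ) (by linarith) hs
    nlinarith
  · have := one_le_rpow_of_pos_of_le_one_of_nonpos hw (by linarith) hs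
    nlinarith

theorem lobeIntegral_le_add_one (hε : ε ∈ Ioo (0 : ℝ) 1) (hx : x ∈ Ico (0 : ℝ) 1) :
    lobeIntegral ε s x ≤ lobeIntegral ε (s + 1) x := by
  have hx' : x ∈ Ioo (-1 : ℝ) 1 := ⟨by linarith [hx.1], hx.2⟩
  rw [← sub_nonneg, lobeIntegral_add_one_sub hε hx']
  refine intervalIntegral.integral_nonneg (amplitude_pos hε hx').le fun θ hθ => ?_
  refine mul_nonneg ?_ (rpow_nonneg (lobe_base_pos hε hx' θ).le s)
  have h := cos_le_cos_of_nonneg_of_le_pi hθ.1 amplitude_le_pi hθ.2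
  have := mul_le_mul_of_nonneg_left h (modulus_pos (x := x) hε).le
  rw [modulus_mul_cos_amplitude hε hx'] at this
  linarith [hx.1]

/-- Cauchy–Schwarz between consecutive exponents. -/
theorem lobeIntegral_sq_le (hε : ε ∈ Ioo (0 : ℝ) 1) (hx : x ∈ Ioo (-1 : ℝ) 1) :
    lobeIntegral ε (s + 1) x ^ 2 ≤ lobeIntegral ε s x * lobeIntegral ε (s + 1 + 1) x := by
  have hc := fun s => (continuous_one_add_mul_cos_rpow
    (abs_modulus_lt_one hε hx) s).intervalIntegrable (μ := volume) 0 (amplitude ε x)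
  have key : ∀ t : ℝ, 0 ≤ t ^ 2 * lobeIntegral ε (s + 1 + 1) x - 2 * t * lobeIntegral ε (s + 1) x
      + lobeIntegral ε s x := by
    intro t
    rw [lobeIntegral, lobeIntegral, lobeIntegral, ← intervalIntegral.integral_const_mul,
      ← intervalIntegral.integral_const_mul,
      ← intervalIntegral.integral_sub ((hc _).const_mul _) ((hc _).const_mul _),
      ← intervalIntegral.integral_add (((hc _).const_mul _).sub ((hc _).const_mul _)) (hc _)]
    refine intervalIntegral.integral_nonneg (amplitude_pos hε hx).le fun θ _ => ?_
    have hw := lobe_base_pos hε hx θ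
    rw [rpow_add_one hw.ne', rpow_add_one hw.ne']
    have := mul_nonneg (rpow_nonneg hw.le s) (sq_nonneg (t * (1 + modulus ε x * cos θ) - 1))
    linarith
  have hR := lobeIntegral_pos (s := s + 1 + 1) hε hx
  have h := key (lobeIntegral ε (s + 1) x / lobeIntegral ε (s + 1 + 1) x)
  field_simp at h
  linarith

end LobeIntegral

section Mass

variable {ε x : ℝ}

/-- The factor `2N ℬ + 1 - √(1 - p₀²)` of the mass, scaled by `2√2 ε`. -/
noncomputable def massFactor (ε x : ℝ) : ℝ :=
  lobeIntegral ε (1 / 2) x + 2 * √2 * ε - 2 * ε * √(1 - x)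

theorem hasDerivAt_lobeIntegral_neg_half (hε : ε ∈ Ioo (0 : ℝ) 1) (hx : x ∈ Ioo (-1 : ℝ) 1) :
    HasDerivAt (lobeIntegral ε (-1 / 2))
      (-ε / (modulus ε x ^ 2 * ((1 + x) * √(1 - x))) - (1 - ε ^ 2) / (2 * modulus ε x ^ 2) * x *
        (lobeIntegral ε (-1 / 2) x - lobeIntegral ε (-3 / 2) x)) x := by
  have ha : 0 < 1 + x := by linarith [hx.1]
  refine (hasDerivAt_lobeIntegral hε hx (-1 / 2)).congr_deriv ?_
  have h : (1 + x) ^ (-1 / 2 : ℝ) = (√(1 + x))⁻¹ := by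
    rw [sqrt_eq_rpow, ← rpow_neg ha.le]; norm_num
  have h' := sq_sqrt ha.le
  have h0 := modulus_pos (x := x) hε
  have ha' : 0 < √(1 + x) := sqrt_pos.2 ha
  have hb : 0 < √(1 - x) := sqrt_pos.2 (by linarith [hx.2])
  rw [h, show (-1 / 2 - 1 : ℝ) = -3 / 2 by norm_num]
  nth_rw 3 [← h']
  field_simp
  ring

theorem hasDerivAt_massFactor (hε : ε ∈ Ioo (0 : ℝ) 1) (hx : x ∈ Ioo (-1 : ℝ) 1) :
    HasDerivAt (massFactor ε)
      (-((1 - ε ^ 2) * ε * (1 + x) * √(1 - x) / modulus ε x ^ 2) +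
        (1 - ε ^ 2) / (2 * modulus ε x ^ 2) * x *
          (lobeIntegral ε (1 / 2) x - lobeIntegral ε (-1 / 2) x)) x := by
  have h0 := modulus_pos (x := x) hε
  have ha : 0 < √(1 + x) := sqrt_pos.2 (by linarith [hx.1])
  have hb : 0 < √(1 - x) := sqrt_pos.2 (by linarith [hx.2])
  have hb' := sq_sqrt (show 0 ≤ 1 - x by linarith [hx.2])
  have hsq : HasDerivAt (fun x : ℝ => √(1 - x)) (-1 / (2 * √(1 - x))) x :=
    ((hasDerivAt_id x).const_sub 1).sqrt (by simpa using (by linarith [hx.2] : (1 - x) ≠ 0))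
  refine (((hasDerivAt_lobeIntegral hε hx (1 / 2)).add_const (2 * √2 * ε)).sub
    (hsq.const_mul (2 * ε))).congr_deriv ?_
  rw [← sqrt_eq_rpow, show (1 / 2 - 1 : ℝ) = -1 / 2 by norm_num]
  have hm := modulus_sq (x := x) hε
  field_simp
  linear_combination 2 * ε * hm + 2 * ε * (1 - ε ^ 2) * (1 + x) * hb'

theorem deriv_lobeIntegral_mul_massFactor_neg (hε : ε ∈ Ioo (0 : ℝ) 1)
    (hx : x ∈ Ioo (-1 : ℝ) 1) : deriv (lobeIntegral ε (-1 / 2) * massFactor ε) x < 0 := by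
  rw [((hasDerivAt_lobeIntegral_neg_half hε hx).mul (hasDerivAt_massFactor hε hx)).deriv]
  have hP := lobeIntegral_pos (s := -1 / 2) hε hx
  have hR := lobeIntegral_pos (s := 1 / 2) hε hx
  have hCS := lobeIntegral_sq_le (s := -3 / 2) hε hx
  have hC := lobeIntegral_add_one_sub_le (s := -1 / 2) hε hx (by norm_num)
  have hD := lobeIntegral_add_one_sub_le (s := -3 / 2) hε hx (by norm_num)
  have hD0 : 0 ≤ x → lobeIntegral ε (-3 / 2) x ≤ lobeIntegral ε (-3 / 2 + 1) x := fun h =>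
    lobeIntegral_le_add_one hε ⟨h, hx.2⟩
  rw [show (-3 / 2 + 1 : ℝ) = -1 / 2 by norm_num] at hD hCS hD0
  rw [show (-1 / 2 + 1 : ℝ) = 1 / 2 by norm_num] at hC hCS
  have hWR : lobeIntegral ε (1 / 2) x ≤ massFactor ε x := by
    have : √(1 - x) ≤ √2 := sqrt_le_sqrt (by linarith [hx.1])
    have := mul_le_mul_of_nonneg_left this hε.1.le
    rw [massFactor]
    linarith
  generalize massFactor ε x = W at *
  generalize lobeIntegral ε (1 / 2) x = R at *
  generalize lobeIntegral ε (-1 / 2) x = P at *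
  generalize lobeIntegral ε (-3 / 2) x = S at *
  have hε0 := hε.1
  have hc : 0 < 1 - ε ^ 2 := by nlinarith [hε.1, hε.2]
  have hδ := modulus_pos (x := x) hε
  have ha : 0 < √(1 + x) := sqrt_pos.2 (by linarith [hx.1])
  have hb : 0 < √(1 - x) := sqrt_pos.2 (by linarith [hx.2])
  have ha2 : √(1 + x) ^ 2 = 1 + x := sq_sqrt (by linarith [hx.1])
  have hb2 : √(1 - x) ^ 2 = 1 - x := sq_sqrt (by linarith [hx.2])
  generalize √(1 + x) = a at *
  generalize √(1 - x) = b at *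
  generalize modulus ε x = δ at *
  rw [← ha2]
  set k := (1 - ε ^ 2) / (2 * δ ^ 2) with hk
  have hk0 : 0 < k := by positivity
  have e1 : (1 - ε ^ 2) * ε * a ^ 2 * b / δ ^ 2 = 2 * k * ε * a ^ 2 * b := by
    rw [hk]; field_simp
  rw [e1]
  set q := ε / (δ ^ 2 * (a ^ 2 * b)) with hq
  have hq0 : 0 < q := by positivity
  rw [neg_div, ← hq]
  rcases le_or_gt 0 x with h | h
  · have hP' : -q - k * x * (P - S) < 0 := by
      have := mul_nonneg (mul_nonneg hk0.le h) (sub_nonneg.2 (hD0 h))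
      linarith
    have hW' : -(2 * k * ε * a ^ 2 * b) + k * x * (R - P) < 0 := by
      have h1 := mul_le_mul_of_nonneg_left hC (mul_nonneg hk0.le h)
      have h2 : x < 2 * a := by nlinarith [hx.2]
      have h3 := mul_pos (mul_pos (mul_pos hk0 hε0) (mul_pos ha hb)) (sub_pos.2 h2)
      linarith
    have := mul_neg_of_neg_of_pos hP' (hR.trans_le hWR)
    have := mul_neg_of_pos_of_neg hP hW'
    linarith
  · have hkx : 0 < k * -x := mul_pos hk0 (neg_pos.2 h)
    have hP' : -q - k * x * (P - S) < 0 := by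
      have h1 := mul_le_mul_of_nonneg_left hD hkx.le
      have h2 : k * -x * (ε * (a * b)) < q := by
        rw [hq, hk, lt_div_iff₀ (by positivity)]
        have h3 : (1 - ε ^ 2) / (2 * δ ^ 2) * -x * (ε * (a * b)) * (δ ^ 2 * (a ^ 2 * b)) =
            ε * ((1 - ε ^ 2) * (-x * (a * (a ^ 2 * b ^ 2)))) / 2 := by
          field_simp
        have h4 : a < 1 := by nlinarith
        have h5 : a ^ 2 * b ^ 2 ≤ 1 := by rw [ha2, hb2]; nlinarith
        have h6 : a * (a ^ 2 * b ^ 2) ≤ 1 := mul_le_one₀ h4.le (by positivity) h5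
        have h7 : -x * (a * (a ^ 2 * b ^ 2)) ≤ 1 :=
          mul_le_one₀ (by linarith [hx.1]) (by positivity) h6
        have h8 : (1 - ε ^ 2) * (-x * (a * (a ^ 2 * b ^ 2))) ≤ 1 :=
          mul_le_one₀ (by nlinarith) (mul_nonneg (by linarith) (by positivity)) h7
        rw [h3]
        nlinarith
      linarith
    have h1 := mul_le_mul_of_nonpos_left hWR hP'.le
    have h2 : 0 < q * R := mul_pos hq0 hR
    have h3 : 0 < P * (2 * k * ε * a ^ 2 * b) := by positivity
    have h4 := mul_nonneg hkx.le (sub_nonneg.2 hCS)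
    linarith

end Mass

section ChangeOfVariables

theorem inv_two_mul_mem {N : ℕ} (hN : 1 ≤ N) : 1 / (2 * (N : ℝ)) ∈ Ioo (0 : ℝ) 1 := by
  have : (1 : ℝ) ≤ N := by exact_mod_cast hN
  refine ⟨by positivity, ?_⟩
  rw [div_lt_one (by positivity)]
  linarith

theorem two_mul_sq_sub_one_mem {p : ℝ} (hp : p ∈ Ioo (0 : ℝ) 1) :
    2 * p ^ 2 - 1 ∈ Ioo (-1 : ℝ) 1 := by
  constructor <;> nlinarith [hp.1, hp.2]

theorem Ezero_eq {N : ℕ} (hN : 1 ≤ N) (p : ℝ) :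
    Ezero N p = (modulus (1 / (2 * N)) (2 * p ^ 2 - 1) ^ 2 - 1) / 4 := by
  have : (N : ℝ) ≠ 0 := by positivity
  rw [modulus_sq (inv_two_mul_mem hN), Ezero, A]
  field_simp
  ring

/-- The substitution `u² = (1 + δ cos θ) / 2`. -/
theorem integral_div_sqrt_energy {N : ℕ} (hN : 1 ≤ N) {p : ℝ} (hp : p ∈ Ioo (0 : ℝ) 1)
    (G : ℝ → ℝ) :
    ∫ u in p..pPlus (Ezero N p), G u / √(Ezero N p + A u) =
      ∫ θ in (0)..amplitude (1 / (2 * N)) (2 * p ^ 2 - 1),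
        G √((1 + modulus (1 / (2 * N)) (2 * p ^ 2 - 1) * cos θ) / 2) /
          (2 * √((1 + modulus (1 / (2 * N)) (2 * p ^ 2 - 1) * cos θ) / 2)) := by
  have hε := inv_two_mul_mem hN
  have hx := two_mul_sq_sub_one_mem hp
  rw [Ezero_eq hN]
  have hcos := modulus_mul_cos_amplitude hε hx
  have hδ := modulus_pos (x := 2 * p ^ 2 - 1) hε
  have hpos := lobe_base_pos hε hx
  have hφ := amplitude_pos hε hx
  have hφπ := amplitude_le_pi (ε := 1 / (2 * N)) (x := 2 * p ^ 2 - 1)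
  generalize modulus (1 / (2 * N)) (2 * p ^ 2 - 1) = δ at *
  generalize amplitude (1 / (2 * N)) (2 * p ^ 2 - 1) = φ at *
  set f : ℝ → ℝ := fun θ => √((1 + δ * cos θ) / 2) with hf
  have hfpos : ∀ θ, 0 < f θ := fun θ => sqrt_pos.2 (half_pos (hpos θ))
  have hfsq : ∀ θ, f θ ^ 2 = (1 + δ * cos θ) / 2 := fun θ => sq_sqrt (half_pos (hpos θ)).le
  have hderiv : ∀ θ, HasDerivAt f (-(δ * sin θ / (4 * f θ))) θ := by
    intro θ
    have h : HasDerivAt (fun θ => (1 + δ * cos θ) / 2) (δ * -sin θ / 2) θ :=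
      (((hasDerivAt_cos θ).const_mul δ).const_add 1).div_const 2
    refine (h.sqrt (half_pos (hpos θ)).ne').congr_deriv ?_
    change _ / (2 * f θ) = _
    have := (hfpos θ).ne'
    field_simp
    norm_num
  have hanti : AntitoneOn f (Icc 0 φ) := by
    intro s hs t ht hst
    have h := cos_le_cos_of_nonneg_of_le_pi hs.1 (ht.2.trans hφπ) hst
    exact sqrt_le_sqrt (by nlinarith)
  have hf0 : f 0 = pPlus ((δ ^ 2 - 1) / 4) := by
    rw [pPlus, show 1 + 4 * ((δ ^ 2 - 1) / 4) = δ ^ 2 by ring, sqrt_sq hδ.le, hf]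
    simp
  have hfφ : f φ = p := by
    rw [hf]
    simp only
    rw [hcos, show (1 + (2 * p ^ 2 - 1)) / 2 = p ^ 2 by ring, sqrt_sq hp.1.le]
  have hle : p ≤ f 0 := hfφ ▸ hanti (left_mem_Icc.2 hφ.le) (right_mem_Icc.2 hφ.le) hφ.le
  have himage : f '' Icc 0 φ = Icc p (f 0) := by
    refine Subset.antisymm ?_ ?_
    · rw [← hfφ]
      exact hanti.image_Icc_subset
    · have := intermediate_value_Icc' hφ.le
        (fun θ _ => (hderiv θ).continuousAt.continuousWithinAt : ContinuousOn f (Icc 0 φ))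
      rwa [hfφ] at this
  rw [← hf0, intervalIntegral.integral_of_le hle, intervalIntegral.integral_of_le hφ.le,
    ← integral_Icc_eq_integral_Ioc, ← himage,
    integral_image_eq_integral_deriv_smul_of_antitoneOn measurableSet_Icc
      (fun θ _ => (hderiv θ).hasDerivWithinAt) hanti,
    integral_Icc_eq_integral_Ioo, integral_Ioc_eq_integral_Ioo]
  refine setIntegral_congr_fun measurableSet_Ioo fun θ hθ => ?_
  have hsin : 0 < sin θ := sin_pos_of_pos_of_lt_pi hθ.1 (hθ.2.trans_le hφπ)
  have henergy : (δ ^ 2 - 1) / 4 + A (f θ) = (δ * sin θ / 2) ^ 2 := by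
    rw [A, hfsq]
    linear_combination -δ ^ 2 / 4 * sin_sq_add_cos_sq θ
  simp only [smul_eq_mul]
  rw [henergy, sqrt_sq (by positivity)]
  have := hfpos θ
  change _ = G (f θ) / (2 * f θ)
  field_simp
  ring

theorem calT_eq {N : ℕ} (hN : 1 ≤ N) {p : ℝ} (hp : p ∈ Ioo (0 : ℝ) 1) :
    calT N p = lobeIntegral (1 / (2 * N)) (-1 / 2) (2 * p ^ 2 - 1) / √2 := by
  rw [calT, integral_div_sqrt_energy hN hp fun _ => 1, lobeIntegral,
    ← intervalIntegral.integral_div]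
  refine intervalIntegral.integral_congr fun θ _ => ?_
  have hw := lobe_base_pos (inv_two_mul_mem hN) (two_mul_sq_sub_one_mem hp) θ
  generalize 1 + modulus (1 / (2 * N)) (2 * p ^ 2 - 1) * cos θ = w at *
  have h2 : √2 ^ 2 = (2 : ℝ) := sq_sqrt (by norm_num)
  have hs : 0 < √w := sqrt_pos.2 hw
  rw [show (-1 / 2 : ℝ) = -(1 / 2) by norm_num, rpow_neg hw.le, ← sqrt_eq_rpow, sqrt_div hw.le]
  field_simp
  linarith

theorem calB_eq {N : ℕ} (hN : 1 ≤ N) {p : ℝ} (hp : p ∈ Ioo (0 : ℝ) 1) :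
    calB N p = lobeIntegral (1 / (2 * N)) (1 / 2) (2 * p ^ 2 - 1) / (2 * √2) := by
  rw [calB, integral_div_sqrt_energy hN hp fun u => u ^ 2, lobeIntegral,
    ← intervalIntegral.integral_div]
  refine intervalIntegral.integral_congr fun θ _ => ?_
  have hw := lobe_base_pos (inv_two_mul_mem hN) (two_mul_sq_sub_one_mem hp) θ
  generalize 1 + modulus (1 / (2 * N)) (2 * p ^ 2 - 1) * cos θ = w at *
  have hs : 0 < √w := sqrt_pos.2 hw
  rw [← sqrt_eq_rpow, sqrt_div hw.le]
  field_simp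

theorem calM_eq {N : ℕ} (hN : 1 ≤ N) {p : ℝ} (hp : p ∈ Ioo (0 : ℝ) 1) :
    calM N p = N / 2 * (lobeIntegral (1 / (2 * N)) (-1 / 2) * massFactor (1 / (2 * N)))
      (2 * p ^ 2 - 1) := by
  have h2 : √2 ^ 2 = (2 : ℝ) := sq_sqrt (by norm_num)
  have hN0 : (0 : ℝ) < N := by exact_mod_cast hN
  have hsq : √(1 - (2 * p ^ 2 - 1)) = √2 * √(1 - p ^ 2) := by
    rw [← sqrt_mul (by norm_num)]
    ring_nf
  rw [calM, calT_eq hN hp, calB_eq hN hp, Pi.mul_apply, massFactor, hsq]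
  generalize lobeIntegral (1 / (2 * N)) (-1 / 2) (2 * p ^ 2 - 1) = P
  generalize lobeIntegral (1 / (2 * N)) (1 / 2) (2 * p ^ 2 - 1) = R
  field_simp
  linear_combination (-P * R * N - P * √2 * (1 - √(1 - p ^ 2))) * h2

end ChangeOfVariables

theorem contDiffOn_lobeIntegral_mul_massFactor {ε : ℝ} (hε : ε ∈ Ioo (0 : ℝ) 1) :
    ContDiffOn ℝ 1 (lobeIntegral ε (-1 / 2) * massFactor ε) (Ioo (-1) 1) := by
  have hJ : ∀ s, ContinuousOn (lobeIntegral ε s) (Ioo (-1) 1) := fun s x hx =>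
    (hasDerivAt_lobeIntegral hε hx s).continuousAt.continuousWithinAt
  have hδ : ContinuousOn (modulus ε) (Ioo (-1) 1) := fun x _ =>
    (hasDerivAt_modulus hε).continuousAt.continuousWithinAt
  have hδ0 : ∀ x ∈ Ioo (-1 : ℝ) 1, modulus ε x ^ 2 ≠ 0 := fun x _ =>
    (pow_pos (modulus_pos hε) 2).ne'
  have hδ2 : ∀ x ∈ Ioo (-1 : ℝ) 1, 2 * modulus ε x ^ 2 ≠ 0 := fun x hx =>
    mul_ne_zero two_ne_zero (hδ0 x hx)
  have hden : ∀ x ∈ Ioo (-1 : ℝ) 1, modulus ε x ^ 2 * ((1 + x) * √(1 - x)) ≠ 0 := fun x hx =>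
    mul_ne_zero (hδ0 x hx) (mul_ne_zero (by linarith [hx.1])
      (sqrt_pos.2 (by linarith [hx.2])).ne')
  have h : ∀ {f f' : ℝ → ℝ}, (∀ x ∈ Ioo (-1 : ℝ) 1, HasDerivAt f (f' x) x) →
      ContinuousOn f' (Ioo (-1) 1) → ContDiffOn ℝ 1 f (Ioo (-1) 1) := by
    intro f f' hf hf'
    rw [show (1 : WithTop ℕ∞) = 0 + 1 by simp, contDiffOn_succ_iff_deriv_of_isOpen isOpen_Ioo]
    refine ⟨fun x hx => (hf x hx).differentiableAt.differentiableWithinAt, by simp, ?_⟩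
    exact contDiffOn_zero.2 (hf'.congr fun x hx => (hf x hx).deriv)
  refine (h (fun x hx => hasDerivAt_lobeIntegral_neg_half hε hx) ?_).mul
    (h (fun x hx => hasDerivAt_massFactor hε hx) ?_)
  · have := hJ (-1 / 2)
    have := hJ (-3 / 2)
    fun_prop (disch := assumption)
  · have := hJ (-1 / 2)
    have := hJ (1 / 2)
    fun_prop (disch := assumption)

/-- for every integer `N ≥ 1`, `ℳ` is `C¹` and strictly decreasing on `(0,1)`,
with `ℳ'(p₀) < 0` for every `p₀ ∈ (0,1)`. -/
theorem calM_strictly_decreasing (N : ℕ) (hN : 1 ≤ N) :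
    ContDiffOn ℝ 1 (calM N) (Set.Ioo 0 1) ∧
    StrictAntiOn (calM N) (Set.Ioo 0 1) ∧
    ∀ p₀ ∈ Set.Ioo (0 : ℝ) 1, deriv (calM N) p₀ < 0 := by
  have hε := inv_two_mul_mem hN
  have hN0 : (0 : ℝ) < N := by exact_mod_cast hN
  have hM := contDiffOn_lobeIntegral_mul_massFactor hε
  have hC : ContDiffOn ℝ 1 (calM N) (Ioo 0 1) :=
    (contDiffOn_const.mul (hM.comp (g := lobeIntegral (1 / (2 * N)) (-1 / 2) * massFactor _)
      (f := fun p : ℝ => 2 * p ^ 2 - 1) (by fun_prop)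
      fun p hp => two_mul_sq_sub_one_mem hp)).congr fun p hp => calM_eq hN hp
  have hneg : ∀ p₀ ∈ Ioo (0 : ℝ) 1, deriv (calM N) p₀ < 0 := by
    intro p hp
    have hx := two_mul_sq_sub_one_mem hp
    have hd := ((hM.differentiableOn one_ne_zero).differentiableAt
      (isOpen_Ioo.mem_nhds hx)).hasDerivAt
    have hq : HasDerivAt (fun p : ℝ => 2 * p ^ 2 - 1) (4 * p) p :=
      (((hasDerivAt_pow 2 p).const_mul 2).sub_const 1).congr_deriv (by norm_num; ring)
    have hev := (isOpen_Ioo.eventually_mem hp).mono fun p hp => calM_eq hN hp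
    rw [(((hd.comp p hq).const_mul (N / 2 : ℝ)).congr_of_eventuallyEq hev).deriv]
    exact mul_neg_of_pos_of_neg (by positivity)
      (mul_neg_of_neg_of_pos (deriv_lobeIntegral_mul_massFactor_neg hε hx) (by linarith [hp.1]))
  refine ⟨hC, strictAntiOn_of_deriv_neg (convex_Ioo 0 1) hC.continuousOn ?_, hneg⟩
  rwa [interior_Ioo]
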